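/- arXiv:2103.04888 — 2 statements merged into one kernel-verified Lean document; each statement's English description precedes it below -/
import Mathlib

section
/- Let 𝔐 = ((m_1,k_1),…,(m_r,k_r)) be a factorization structure of degree m and let (p_j)_{j∈ℕ} be a sequence in F^𝔐 converging in ℙ^m to q with deg q = m. For each j choose α_j ∈ ℂ nonzero and irreducible, pairwise non-associated p_{j,1} ∈ 𝒫^{m_1}, …, p_{j,r} ∈ 𝒫^{m_r} with ‖p_{j,i}‖ = 1 for all i and p_j = α_j · p_{j,1}^{k_1} ⋯ p_{j,r}^{k_r}. Then there exist α ∈ ℂ, polynomials q_1,…,q_r with deg q_i = m_i and q = α · q_1^{k_1} ⋯ q_r^{k_r}, and a strictly increasing φ : ℕ → ℕ such that α_{φ(s)} → α and p_{φ(s),i} → q_i for each i as s → ∞. If moreover q ∈ F^𝔐, with irreducible factorization q = β·Q_1^{k_1}⋯Q_r^{k_r} (Q_i ∈ 𝒫^{m_i} irreducible, pairwise non-associated, ‖Q_i‖ = 1), then the whole sequence of factorizations converges to that of q: the minimum, over permutations σ of {1,…,r} with k_{σ(i)} = k_i for all i, of max_i sin(p_{j,i}, Q_{σ(i)}) tends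 to 0 as j → ∞. -/
open scoped Classical

/-- The Hermitian inner product on coefficients of multivariate polynomials
(conjugate-linear in the first argument). -/
noncomputable def pInner {ℓ : ℕ} (p q : MvPolynomial (Fin ℓ) ℂ) : ℂ :=
  ∑ d ∈ p.support ∪ q.support, (starRingEnd ℂ) (MvPolynomial.coeff d p) * MvPolynomial.coeff d q

/-- The coefficient norm `‖p‖ := √⟪p,p⟫`. -/
noncomputable def pNorm {ℓ : ℕ} (p : MvPolynomial (Fin ℓ) ℂ) : ℝ :=
  Real.sqrt (pInner p p).re

/-- The sine of the principal angle between the spans of two polynomials. -/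
noncomputable def psin {ℓ : ℕ} (p q : MvPolynomial (Fin ℓ) ℂ) : ℝ :=
  if p = 0 then (if q = 0 then 0 else 1)
  else if q = 0 then 1
  else pNorm (((pNorm p : ℂ))⁻¹ • p -
        (pInner q p / ((pNorm q : ℂ) * (pNorm p : ℂ))) • (((pNorm q : ℂ))⁻¹ • q))

open scoped MvPowerSeries.WithPiTopology
open Filter Topology

section Norm

variable {ℓ : ℕ}

/-- The inner product may be computed over any finite set containing the support of the first
argument. -/
lemma pInner_eq_sum {p : MvPolynomial (Fin ℓ) ℂ} {S : Finset (Fin ℓ →₀ ℕ)} (hp : p.support ⊆ S)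
    (q : MvPolynomial (Fin ℓ) ℂ) :
    pInner p q = ∑ d ∈ S, (starRingEnd ℂ) (p.coeff d) * q.coeff d := by
  have h : ∀ T : Finset (Fin ℓ →₀ ℕ), p.support ⊆ T →
      ∑ d ∈ T, (starRingEnd ℂ) (p.coeff d) * q.coeff d =
        ∑ d ∈ p.support, (starRingEnd ℂ) (p.coeff d) * q.coeff d := fun T hT =>
    (Finset.sum_subset hT fun d _ hd => by
      rw [MvPolynomial.notMem_support_iff.mp hd, map_zero, zero_mul]).symm
  rw [pInner, h _ Finset.subset_union_left, h S hp]

lemma pInner_self {p : MvPolynomial (Fin ℓ) ℂ} {S : Finset (Fin ℓ →₀ ℕ)} (hp : p.support ⊆ S) :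
    pInner p p = ((∑ d ∈ S, ‖p.coeff d‖ ^ 2 : ℝ) : ℂ) := by
  rw [pInner_eq_sum hp]
  push_cast
  exact Finset.sum_congr rfl fun d _ => Complex.conj_mul' _

lemma pNorm_eq_sqrt {p : MvPolynomial (Fin ℓ) ℂ} {S : Finset (Fin ℓ →₀ ℕ)} (hp : p.support ⊆ S) :
    pNorm p = √(∑ d ∈ S, ‖p.coeff d‖ ^ 2) := by
  rw [pNorm, pInner_self hp, Complex.ofReal_re]

lemma pNorm_zero : pNorm (0 : MvPolynomial (Fin ℓ) ℂ) = 0 := by simp [pNorm, pInner]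

lemma pNorm_nonneg (p : MvPolynomial (Fin ℓ) ℂ) : 0 ≤ pNorm p := Real.sqrt_nonneg _

lemma pInner_self_eq_sq (p : MvPolynomial (Fin ℓ) ℂ) : pInner p p = (pNorm p : ℂ) ^ 2 := by
  rw [pNorm_eq_sqrt subset_rfl, pInner_self subset_rfl, ← Complex.ofReal_pow, Real.sq_sqrt]
  positivity

lemma norm_coeff_le_pNorm (p : MvPolynomial (Fin ℓ) ℂ) (d : Fin ℓ →₀ ℕ) :
    ‖p.coeff d‖ ≤ pNorm p := by
  rw [pNorm_eq_sqrt (Finset.subset_insert d p.support)]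
  apply Real.le_sqrt_of_sq_le
  exact Finset.single_le_sum (f := fun d => ‖p.coeff d‖ ^ 2) (fun _ _ => by positivity)
    (Finset.mem_insert_self _ _)

lemma ne_zero_of_pNorm_eq_one {p : MvPolynomial (Fin ℓ) ℂ} (hp : pNorm p = 1) : p ≠ 0 := by
  rintro rfl
  exact zero_ne_one (pNorm_zero.symm.trans hp)

lemma psin_nonneg (p q : MvPolynomial (Fin ℓ) ℂ) : 0 ≤ psin p q := by
  unfold psin
  split_ifs <;> first | exact pNorm_nonneg _ | norm_num

lemma psin_of_pNorm_eq_one {p q : MvPolynomial (Fin ℓ) ℂ} (hp : pNorm p = 1) (hq : pNorm q = 1) :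
    psin p q = pNorm (p - pInner q p • q) := by
  simp [psin, ne_zero_of_pNorm_eq_one hp, ne_zero_of_pNorm_eq_one hq, hp, hq]

end Norm

section Convergence

variable {ℓ : ℕ} {ι : Type*} {l : Filter ι} {f : ι → MvPolynomial (Fin ℓ) ℂ}
  {g : MvPolynomial (Fin ℓ) ℂ}

/-- With uniformly bounded supports, the norm converges along coefficientwise convergence. -/
lemma tendsto_pNorm {S : Finset (Fin ℓ →₀ ℕ)} (hf : ∀ j, (f j).support ⊆ S) (hg : g.support ⊆ S)
    (h : ∀ d, Tendsto (fun j => (f j).coeff d) l (𝓝 (g.coeff d))) :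
    Tendsto (fun j => pNorm (f j)) l (𝓝 (pNorm g)) := by
  simp_rw [pNorm_eq_sqrt (hf _), pNorm_eq_sqrt hg]
  exact (tendsto_finsetSum _ fun d _ => ((h d).norm.pow 2)).sqrt

lemma tendsto_pNorm_sub {S : Finset (Fin ℓ →₀ ℕ)} (hf : ∀ j, (f j).support ⊆ S)
    (h : ∀ d, Tendsto (fun j => (f j).coeff d) l (𝓝 (g.coeff d))) :
    Tendsto (fun j => pNorm (f j - g)) l (𝓝 0) := by
  rw [← pNorm_zero (ℓ := ℓ)]
  refine tendsto_pNorm (S := S ∪ g.support) (fun j => ?_) (by simp) fun d => ?_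
  · exact (MvPolynomial.support_sub _ _ _).trans (Finset.union_subset_union_left (hf j))
  · simpa using (h d).sub_const (g.coeff d)

lemma tendsto_coeff_of_tendsto_pNorm_sub (h : Tendsto (fun j => pNorm (f j - g)) l (𝓝 0))
    (d : Fin ℓ →₀ ℕ) : Tendsto (fun j => (f j).coeff d) l (𝓝 (g.coeff d)) := by
  rw [tendsto_iff_norm_sub_tendsto_zero]
  refine squeeze_zero (fun _ => norm_nonneg _) (fun j => ?_) h
  simpa using norm_coeff_le_pNorm (f j - g) d

lemma tendsto_toMvPowerSeries_iff :
    Tendsto (fun j => (f j : MvPowerSeries (Fin ℓ) ℂ)) l (𝓝 (g : MvPowerSeries (Fin ℓ) ℂ)) ↔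
      ∀ d, Tendsto (fun j => (f j).coeff d) l (𝓝 (g.coeff d)) := by
  simp [MvPowerSeries.WithPiTopology.tendsto_iff_coeff_tendsto]

/-- Coefficientwise convergence is compatible with products of powers. -/
lemma tendsto_coeff_prod_pow {κ : Type*} [Fintype κ] {F : ι → κ → MvPolynomial (Fin ℓ) ℂ}
    {G : κ → MvPolynomial (Fin ℓ) ℂ} (k : κ → ℕ)
    (h : ∀ i d, Tendsto (fun j => (F j i).coeff d) l (𝓝 ((G i).coeff d))) (d : Fin ℓ →₀ ℕ) :
    Tendsto (fun j => (∏ i, F j i ^ k i).coeff d) l (𝓝 ((∏ i, G i ^ k i).coeff d)) := by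
  refine tendsto_toMvPowerSeries_iff.mp ?_ d
  have hp := tendsto_finsetProd (Finset.univ : Finset κ)
    fun i _ => (tendsto_toMvPowerSeries_iff.mpr (h i)).pow (k i)
  have hcoe : ∀ H : κ → MvPolynomial (Fin ℓ) ℂ,
      ((∏ i, H i ^ k i : MvPolynomial (Fin ℓ) ℂ) : MvPowerSeries (Fin ℓ) ℂ) =
        ∏ i, (H i : MvPowerSeries (Fin ℓ) ℂ) ^ k i := fun H =>
    (map_prod (MvPolynomial.coeToMvPowerSeries.ringHom (σ := Fin ℓ) (R := ℂ))
      (fun i => H i ^ k i) Finset.univ).trans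
        (Finset.prod_congr rfl fun i _ => MvPolynomial.coe_pow _)
  simpa only [hcoe] using hp

/-- If normalized polynomials converge coefficientwise to an associate of a normalized polynomial,
the angle to the latter tends to zero. -/
lemma tendsto_psin_of_associated {S : Finset (Fin ℓ →₀ ℕ)} {q : MvPolynomial (Fin ℓ) ℂ}
    (hf : ∀ j, (f j).support ⊆ S) (hf1 : ∀ j, pNorm (f j) = 1) (hq : pNorm q = 1)
    (hgq : Associated q g) (h : ∀ d, Tendsto (fun j => (f j).coeff d) l (𝓝 (g.coeff d))) :
    Tendsto (fun j => psin (f j) q) l (𝓝 0) := by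
  obtain ⟨u, rfl⟩ := hgq
  obtain ⟨c, -, hc⟩ := MvPolynomial.isUnit_iff_eq_C_of_isReduced.mp u.isUnit
  simp_rw [psin_of_pNorm_eq_one (hf1 _) hq]
  rw [hc, mul_comm] at h
  simp_rw [MvPolynomial.coeff_C_mul] at h
  have hin : Tendsto (fun j => pInner q (f j)) l (𝓝 c) := by
    have hs : c = ∑ d ∈ q.support, (starRingEnd ℂ) (q.coeff d) * (c * q.coeff d) := by
      calc c = c * pInner q q := by rw [pInner_self_eq_sq, hq]; simp
        _ = _ := by
          rw [pInner_eq_sum subset_rfl, Finset.mul_sum]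
          exact Finset.sum_congr rfl fun d _ => by ring
    rw [hs]
    simp_rw [pInner_eq_sum (subset_refl q.support)]
    exact tendsto_finsetSum _ fun d _ => (h d).const_mul _
  rw [← pNorm_zero (ℓ := ℓ)]
  refine tendsto_pNorm (S := S ∪ q.support) (fun j => ?_) (by simp) fun d => ?_
  · exact (MvPolynomial.support_sub _ _ _).trans
      (Finset.union_subset_union (hf j) MvPolynomial.support_smul)
  · simpa using (h d).sub (hin.mul_const (q.coeff d))

end Convergence

section Compactness

variable {ℓ : ℕ}

lemma degreeOf_le_iff_support_subset {p : MvPolynomial (Fin ℓ) ℂ} {n : Fin ℓ → ℕ} :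
    (∀ t, p.degreeOf t ≤ n t) ↔
      p.support ⊆ Finset.Iic (Finsupp.equivFunOnFinite.symm n) := by
  simp only [MvPolynomial.degreeOf_le_iff, Finset.subset_iff, Finset.mem_Iic, Finsupp.le_def,
    Finsupp.equivFunOnFinite_symm_apply_apply]
  exact ⟨fun h d hd t => h t d hd, fun h t d hd => h hd t⟩

/-- A sequence of tuples of normalized polynomials with uniformly bounded supports has a
coefficientwise convergent subsequence. -/
lemma exists_subseq_tendsto_coeff {κ : Type*} [Fintype κ]
    {P : ℕ → κ → MvPolynomial (Fin ℓ) ℂ} {S : κ → Finset (Fin ℓ →₀ ℕ)}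
    (hS : ∀ j i, (P j i).support ⊆ S i) (hP : ∀ j i, pNorm (P j i) = 1) :
    ∃ (Q : κ → MvPolynomial (Fin ℓ) ℂ) (φ : ℕ → ℕ), StrictMono φ ∧
      (∀ i, (Q i).support ⊆ S i) ∧
      ∀ i d, Tendsto (fun s => (P (φ s) i).coeff d) atTop (𝓝 ((Q i).coeff d)) := by
  have hK : IsCompact (Set.univ.pi fun _ : κ => Set.univ.pi fun _ : Fin ℓ →₀ ℕ =>
      Metric.closedBall (0 : ℂ) 1) :=
    isCompact_univ_pi fun _ => isCompact_univ_pi fun _ => isCompact_closedBall _ _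
  obtain ⟨g, -, φ, hφ, hg⟩ := hK.tendsto_subseq (x := fun j i d => (P j i).coeff d)
    fun j i _ d _ => by
      rw [mem_closedBall_zero_iff, ← hP j i]
      exact norm_coeff_le_pNorm _ _
  have hg' : ∀ i d, Tendsto (fun s => (P (φ s) i).coeff d) atTop (𝓝 (g i d)) := fun i d =>
    (tendsto_pi_nhds.mp (tendsto_pi_nhds.mp hg i)) d
  have hout : ∀ i d, d ∉ S i → g i d = 0 := fun i d hd => by
    refine tendsto_nhds_unique (hg' i d) ?_
    simp_rw [MvPolynomial.notMem_support_iff.mp fun h => hd (hS _ i h)]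
    exact tendsto_const_nhds
  have hcoeff : ∀ i d, (∑ e ∈ S i, MvPolynomial.monomial e (g i e)).coeff d = g i d := by
    intro i d
    simp only [MvPolynomial.coeff_sum, MvPolynomial.coeff_monomial, Finset.sum_ite_eq',
      ite_eq_left_iff]
    exact fun hd => (hout i d hd).symm
  refine ⟨fun i => ∑ e ∈ S i, MvPolynomial.monomial e (g i e), φ, hφ, fun i d hd => ?_,
    fun i d => ?_⟩
  · by_contra hd'
    exact MvPolynomial.mem_support_iff.mp hd ((hcoeff i d).trans (hout i d hd'))
  · simpa only [hcoeff] using hg' i d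

/-- Normalized factorizations of prescribed multidegrees whose products converge to a nonzero
polynomial of full multidegree subconverge to a factorization of the limit. -/
lemma exists_subseq_tendsto_factorization {r : ℕ} {m : Fin ℓ → ℕ} {mdeg : Fin r → Fin ℓ → ℕ}
    {k : Fin r → ℕ} (hk : ∀ i, 1 ≤ k i) (hsum : ∀ t, ∑ i, k i * mdeg i t = m t)
    {α : ℕ → ℂ} {P : ℕ → Fin r → MvPolynomial (Fin ℓ) ℂ}
    (hdeg : ∀ j i t, (P j i).degreeOf t = mdeg i t) (hnorm : ∀ j i, pNorm (P j i) = 1)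
    {q : MvPolynomial (Fin ℓ) ℂ} (hq0 : q ≠ 0) (hq : ∀ t, q.degreeOf t = m t)
    (hconv : Tendsto (fun j => pNorm (MvPolynomial.C (α j) * ∏ i, P j i ^ k i - q)) atTop (𝓝 0)) :
    ∃ (β : ℂ) (Q : Fin r → MvPolynomial (Fin ℓ) ℂ) (φ : ℕ → ℕ), StrictMono φ ∧
      (∀ i, Q i ≠ 0) ∧ (∀ i t, (Q i).degreeOf t = mdeg i t) ∧
      q = MvPolynomial.C β * ∏ i, Q i ^ k i ∧
      Tendsto (fun s => α (φ s)) atTop (𝓝 β) ∧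
      ∀ i d, Tendsto (fun s => (P (φ s) i).coeff d) atTop (𝓝 ((Q i).coeff d)) := by
  have hS : ∀ j i, (P j i).support ⊆ Finset.Iic (Finsupp.equivFunOnFinite.symm (mdeg i)) :=
    fun j i => degreeOf_le_iff_support_subset.mp fun t => (hdeg j i t).le
  obtain ⟨Q, φ, hφ, hQS, hQ⟩ := exists_subseq_tendsto_coeff hS hnorm
  have hQ0 : ∀ i, Q i ≠ 0 := fun i => by
    have h := tendsto_pNorm (fun s => hS (φ s) i) (hQS i) (hQ i)
    simp_rw [hnorm] at h
    exact ne_zero_of_pNorm_eq_one (tendsto_nhds_unique tendsto_const_nhds h).symm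
  have hG0 : ∏ i, Q i ^ k i ≠ 0 := Finset.prod_ne_zero_iff.mpr fun i _ => pow_ne_zero _ (hQ0 i)
  have hG := tendsto_coeff_prod_pow k hQ
  have hαG : ∀ d, Tendsto (fun s => α (φ s) * (∏ i, P (φ s) i ^ k i).coeff d) atTop
      (𝓝 (q.coeff d)) := fun d => by
    simpa only [MvPolynomial.coeff_C_mul] using
      tendsto_coeff_of_tendsto_pNorm_sub (hconv.comp hφ.tendsto_atTop) d
  obtain ⟨d₀, hd₀⟩ := MvPolynomial.ne_zero_iff.mp hG0
  obtain ⟨β, hβ⟩ : ∃ β, Tendsto (fun s => α (φ s)) atTop (𝓝 β) := by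
    refine ⟨_, ((hαG d₀).div (hG d₀) hd₀).congr' ?_⟩
    filter_upwards [(hG d₀).eventually_ne hd₀] with s hs
    exact mul_div_cancel_right₀ _ hs
  have hqG : q = MvPolynomial.C β * ∏ i, Q i ^ k i := by
    ext d
    rw [MvPolynomial.coeff_C_mul]
    exact tendsto_nhds_unique (hαG d) (hβ.mul (hG d))
  have hβ0 : MvPolynomial.C (σ := Fin ℓ) β ≠ 0 := by
    intro h
    rw [h, zero_mul] at hqG
    exact hq0 hqG
  refine ⟨β, Q, φ, hφ, hQ0, fun i t => ?_, hqG, hβ, hQ⟩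
  have hle : ∀ i t, (Q i).degreeOf t ≤ mdeg i t := fun i =>
    degreeOf_le_iff_support_subset.mpr (hQS i)
  have htot : ∑ i, k i * (Q i).degreeOf t = ∑ i, k i * mdeg i t := by
    rw [hsum, ← hq, hqG, MvPolynomial.degreeOf_mul_eq hβ0 hG0, MvPolynomial.degreeOf_C, zero_add,
      MvPolynomial.degreeOf_prod_eq _ _ fun i _ => pow_ne_zero _ (hQ0 i)]
    exact Finset.sum_congr rfl fun i _ => (MvPolynomial.degreeOf_pow_eq _ _ _ (hQ0 i)).symm
  have hi := (Finset.sum_eq_sum_iff_of_le fun i _ => Nat.mul_le_mul_left (k i) (hle i t)).mp htot i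
    (Finset.mem_univ i)
  exact Nat.eq_of_mul_eq_mul_left (hk i) hi

end Compactness

section UniqueFactorization

variable {ι : Type*} [Fintype ι]

/-- Two weighted sums of singletons with positive weights agree, one of them having distinct
points, only if they differ by a weight-preserving permutation. -/
lemma exists_perm_of_sum_nsmul_singleton_eq {A : Type*} {k : ι → ℕ} (hk : ∀ i, 1 ≤ k i)
    {a b : ι → A} (ha : Function.Injective a)
    (h : ∑ i, k i • ({b i} : Multiset A) = ∑ i, k i • ({a i} : Multiset A)) :
    ∃ σ : Equiv.Perm ι, (∀ i, k (σ i) = k i) ∧ ∀ i, a (σ i) = b i := by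
  have hcount : ∀ (c : ι → A) (x : A),
      (∑ i, k i • ({c i} : Multiset A)).count x = ∑ i, if x = c i then k i else 0 := fun c x => by
    simp [Multiset.count_sum', Multiset.count_singleton]
  have hab : ∀ x, (∑ i, if x = b i then k i else 0) = ∑ i, if x = a i then k i else 0 := fun x => by
    rw [← hcount, ← hcount, h]
  have hpos : ∀ (c : ι → A) i, 0 < ∑ j, if c i = c j then k j else 0 := fun c i =>
    Finset.sum_pos' (fun _ _ => Nat.zero_le _) ⟨i, Finset.mem_univ i, by rw [if_pos rfl]; exact hk i⟩
  have hex : ∀ i, ∃ j, b j = a i := fun i => by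
    by_contra! hne
    have := hpos a i
    rw [← hab, Finset.sum_eq_zero fun j _ => if_neg fun e => hne j e.symm] at this
    exact this.ne rfl
  choose τ hτ using hex
  have hτinj : Function.Injective τ := fun i j hij => ha (by rw [← hτ, ← hτ, hij])
  let τ' : Equiv.Perm ι := Equiv.ofBijective τ (Finite.injective_iff_bijective.mp hτinj)
  have hτ' : ∀ i, a (τ'.symm i) = b i := fun i => by
    rw [← hτ]
    exact congrArg b (τ'.apply_symm_apply i)
  have hb : Function.Injective b := fun i j hij => by
    rw [← hτ', ← hτ'] at hij
    exact τ'.symm.injective (ha hij)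
  refine ⟨τ'.symm, fun i => ?_, hτ'⟩
  have hi := hab (b i)
  rw [← hτ' i] at hi
  simp_rw [ha.eq_iff] at hi
  rw [hτ' i] at hi
  simpa [hb.eq_iff] using hi.symm

open UniqueFactorizationMonoid in
/-- In a unique factorization domain, two factorizations with the same positive exponents, one
into pairwise non-associated irreducibles and the other into nonunits, coincide up to units and
an exponent-preserving permutation. -/
lemma exists_perm_associated_of_prod_pow {R : Type*} [CommRing R] [IsDomain R]
    [UniqueFactorizationMonoid R] {k : ι → ℕ} (hk : ∀ i, 1 ≤ k i) {x y : ι → R}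
    (hx : ∀ i, Irreducible (x i)) (hxne : ∀ i j, i ≠ j → ¬ Associated (x i) (x j))
    (hy0 : ∀ i, y i ≠ 0) (hy : ∀ i, ¬ IsUnit (y i))
    (h : Associated (∏ i, y i ^ k i) (∏ i, x i ^ k i)) :
    ∃ σ : Equiv.Perm ι, (∀ i, k (σ i) = k i) ∧ ∀ i, Associated (x (σ i)) (y i) := by
  let a : ι → Associates R := fun i => Associates.mk (x i)
  let b : ι → Associates R := fun i => Associates.mk (y i)
  have ha : Function.Injective a := fun i j hij => by
    by_contra hne
    exact hxne i j hne (Associates.mk_eq_mk_iff_associated.mp hij)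
  have hab : ∏ i, b i ^ k i = ∏ i, a i ^ k i := by
    have := Associates.mk_eq_mk_iff_associated.mpr h
    simpa [← Associates.finsetProd_mk, Associates.mk_pow] using this
  have ha_irr : ∀ i, Irreducible (a i) := fun i => Associates.irreducible_mk.mpr (hx i)
  have hb0 : ∀ i, b i ≠ 0 := fun i => Associates.mk_ne_zero.mpr (hy0 i)
  have hfac : ∀ c : ι → Associates R, (∀ i, c i ≠ 0) →
      normalizedFactors (∏ i, c i ^ k i) = ∑ i, k i • normalizedFactors (c i) := fun c hc => by
    have hmem : (0 : Associates R) ∉ Finset.univ.val.map fun i => c i ^ k i := by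
      simp only [Multiset.mem_map, not_exists, not_and]
      exact fun i _ => pow_ne_zero _ (hc i)
    rw [Finset.prod_eq_multiset_prod, normalizedFactors_multiset_prod _ hmem, Multiset.map_map,
      Finset.sum_eq_multiset_sum]
    exact congrArg _ (Multiset.map_congr rfl fun i _ => normalizedFactors_pow _)
  have hsum : ∑ i, k i • normalizedFactors (b i) = ∑ i, k i • ({a i} : Multiset (Associates R)) := by
    rw [← hfac b hb0, hab, hfac a fun i => (ha_irr i).ne_zero]
    exact Finset.sum_congr rfl fun i _ => by rw [normalizedFactors_irreducible (ha_irr i),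
      normalize_eq]
  have hcard_pos : ∀ i, 1 ≤ (normalizedFactors (b i)).card := fun i =>
    Multiset.card_pos.mpr ((normalizedFactors_pos _ (hb0 i)).mpr
      (mt Associates.isUnit_mk.mp (hy i))).ne'
  have hcard : ∀ i, (normalizedFactors (b i)).card = 1 := fun i => by
    have hc := congrArg Multiset.card hsum
    simp only [Multiset.card_sum, Multiset.card_nsmul, Multiset.card_singleton] at hc
    have := (Finset.sum_eq_sum_iff_of_le fun i _ => Nat.mul_le_mul_left (k i) (hcard_pos i)).mp
      hc.symm i (Finset.mem_univ i)
    exact (Nat.eq_of_mul_eq_mul_left (hk i) this).symm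
  have hb : ∀ i, normalizedFactors (b i) = {b i} := fun i => by
    obtain ⟨c, hc⟩ := Multiset.card_eq_one.mp (hcard i)
    have hp := associated_iff_eq.mp (prod_normalizedFactors (hb0 i))
    rw [hc, Multiset.prod_singleton] at hp
    rw [hc, hp]
  simp_rw [hb] at hsum
  obtain ⟨σ, hσ, hσ'⟩ := exists_perm_of_sum_nsmul_singleton_eq hk ha hsum
  exact ⟨σ, hσ, fun i => Associates.mk_eq_mk_iff_associated.mp (hσ' i)⟩

end UniqueFactorization

/-- Convergence of factorizations along a converging sequence in a factorization manifold
`F^𝔐`, `𝔐 = ((m_1,k_1),…,(m_r,k_r))`: any sequence of normalized irreducible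
factorizations of elements `p_j ∈ F^𝔐` converging to `q ∈ 𝒫^m` has a subsequence whose
factor tuples converge to a factorization of `q` with degrees `m_1,…,m_r`; and if
moreover `q ∈ F^𝔐` with normalized irreducible factorization `β·Q_1^{k_1}⋯Q_r^{k_r}`,
the whole sequence of factorizations converges to that of `q` in factorization distance. -/
theorem factorization_sequence_convergence (ℓ : ℕ) (hl : 1 ≤ ℓ) (m : Fin ℓ → ℕ)
    (hm : m ≠ 0) (r : ℕ) (hr : 1 ≤ r) (mdeg : Fin r → Fin ℓ → ℕ) (k : Fin r → ℕ)
    (hmdeg : ∀ i, mdeg i ≠ 0) (hk : ∀ i, 1 ≤ k i)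
    (hsum : ∀ t, ∑ i, k i * mdeg i t = m t)
    (α : ℕ → ℂ) (P : ℕ → Fin r → MvPolynomial (Fin ℓ) ℂ)
    (hα : ∀ j, α j ≠ 0)
    (hirr : ∀ j i, Irreducible (P j i))
    (hdeg : ∀ j i t, (P j i).degreeOf t = mdeg i t)
    (hassoc : ∀ j, ∀ i i' : Fin r, i ≠ i' → ¬ Associated (P j i) (P j i'))
    (hnorm : ∀ j i, pNorm (P j i) = 1)
    (q : MvPolynomial (Fin ℓ) ℂ) (hq : ∀ t, q.degreeOf t = m t)
    (hconv : Filter.Tendsto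
      (fun j => pNorm (MvPolynomial.C (α j) * ∏ i, P j i ^ k i - q))
      Filter.atTop (nhds 0)) :
    (∃ (β : ℂ) (Q : Fin r → MvPolynomial (Fin ℓ) ℂ) (φ : ℕ → ℕ),
      StrictMono φ ∧
      (∀ i t, (Q i).degreeOf t = mdeg i t) ∧
      q = MvPolynomial.C β * ∏ i, Q i ^ k i ∧
      Filter.Tendsto (fun s => α (φ s)) Filter.atTop (nhds β) ∧
      (∀ i, Filter.Tendsto (fun s => pNorm (P (φ s) i - Q i)) Filter.atTop (nhds 0)))
    ∧
    (∀ (β : ℂ) (Q : Fin r → MvPolynomial (Fin ℓ) ℂ),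
      β ≠ 0 → (∀ i, Irreducible (Q i)) → (∀ i t, (Q i).degreeOf t = mdeg i t) →
      (∀ i i' : Fin r, i ≠ i' → ¬ Associated (Q i) (Q i')) →
      (∀ i, pNorm (Q i) = 1) →
      q = MvPolynomial.C β * ∏ i, Q i ^ k i →
      Filter.Tendsto (fun j =>
          (Finset.univ.filter (fun σ : Equiv.Perm (Fin r) => ∀ i, k (σ i) = k i)).inf'
            ⟨1, by simp⟩
            (fun σ => (Finset.univ : Finset (Fin r)).sup' ⟨⟨0, hr⟩, Finset.mem_univ _⟩
              (fun i => psin (P j i) (Q (σ i)))))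
        Filter.atTop (nhds 0)) := by
  have hq0 : q ≠ 0 := by
    rintro rfl
    exact hm (funext fun t => by simpa using (hq t).symm)
  constructor
  · obtain ⟨β, Q, φ, hφ, -, hQdeg, hqQ, hβ, hQ⟩ :=
      exists_subseq_tendsto_factorization hk hsum hdeg hnorm hq0 hq hconv
    exact ⟨β, Q, φ, hφ, hQdeg, hqQ, hβ, fun i => tendsto_pNorm_sub
      (fun s => degreeOf_le_iff_support_subset.mp fun t => (hdeg (φ s) i t).le) (hQ i)⟩
  · intro β Q hβ hQirr _ hQassoc hQnorm hqQ
    refine tendsto_of_subseq_tendsto fun ns hns => ?_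
    obtain ⟨γ, L, φ, -, hL0, hLdeg, hqL, -, hL⟩ :=
      exists_subseq_tendsto_factorization (α := fun j => α (ns j)) (P := fun j => P (ns j)) hk hsum
        (fun j => hdeg (ns j)) (fun j => hnorm (ns j)) hq0 hq (hconv.comp hns)
    have hLunit : ∀ i, ¬ IsUnit (L i) := fun i hu => by
      obtain ⟨c, -, hc⟩ := MvPolynomial.isUnit_iff_eq_C_of_isReduced.mp hu
      refine hmdeg i (funext fun t => ?_)
      rw [← hLdeg i t, hc, MvPolynomial.degreeOf_C, Pi.zero_apply]
    have hγ : γ ≠ 0 := by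
      rintro rfl
      exact hq0 (by simpa using hqL)
    have hassocC : ∀ {c : ℂ} {f : MvPolynomial (Fin ℓ) ℂ}, c ≠ 0 →
        Associated (MvPolynomial.C c * f) f := fun {c f} hc =>
      associated_unit_mul_left f _ ((isUnit_iff_ne_zero.mpr hc).map MvPolynomial.C)
    have hLQ : Associated (∏ i, L i ^ k i) (∏ i, Q i ^ k i) :=
      (hassocC hγ).symm.trans ((hqL.symm.trans hqQ) ▸ hassocC hβ)
    obtain ⟨σ, hσ, hσL⟩ := exists_perm_associated_of_prod_pow hk hQirr hQassoc hL0 hLunit hLQ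
    refine ⟨φ, ?_⟩
    have hpsin : ∀ i, Tendsto (fun s => psin (P (ns (φ s)) i) (Q (σ i))) atTop (𝓝 0) := fun i =>
      tendsto_psin_of_associated
        (fun s => degreeOf_le_iff_support_subset.mp fun t => (hdeg (ns (φ s)) i t).le)
        (fun s => hnorm _ i) (hQnorm _) (hσL i) (hL i)
    have hsum0 : Tendsto (fun s => ∑ i, psin (P (ns (φ s)) i) (Q (σ i))) atTop (𝓝 0) := by
      simpa using tendsto_finsetSum Finset.univ fun i _ => hpsin i
    refine squeeze_zero (fun s => ?_) (fun s => ?_) hsum0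
    · exact Finset.le_inf' _ _ fun τ _ =>
        (psin_nonneg _ _).trans (Finset.le_sup' (fun i => psin (P (ns (φ s)) i) (Q (τ i)))
          (Finset.mem_univ ⟨0, hr⟩))
    · refine (Finset.inf'_le _ (Finset.mem_filter.mpr ⟨Finset.mem_univ σ, hσ⟩)).trans ?_
      exact Finset.sup'_le _ _ fun i hi => Finset.single_le_sum
        (f := fun i => psin (P (ns (φ s)) i) (Q (σ i))) (fun _ _ => psin_nonneg _ _) hi
end

section
/- (Degree-combining embedding) Let f_1, f_2 ∈ R be irreducible and non-associated with deg f_1 = n_1 and deg f_2 = n_2, where n_1 + n_2 has at least two distinct indices i with (n_1 + n_2)_i > 0 (a non-univariate degree). Let g ∈ R, k ≥ 1, f := f_1^k · f_2^k · g, and m := deg f. Then f lies in the closure, in ℙ^m, of the set {p^k · g : p ∈ R irreducible with deg p = n_1 + n_2}. -/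
open scoped Classical

open MvPolynomial

/-- The multidegree of a polynomial in finitely many variables, as an exponent vector. -/
noncomputable def multidegree {σ R : Type*} [Fintype σ] [CommSemiring R]
    (p : MvPolynomial σ R) : σ →₀ ℕ :=
  Finsupp.equivFunOnFinite.symm fun i => p.degreeOf i

/-- The polynomial with prescribed coefficients on a finite set of exponents. -/
noncomputable def ofCoeffs {σ R : Type*} [CommSemiring R] (s : Finset (σ →₀ ℕ)) (c : s → R) :
    MvPolynomial σ R :=
  ∑ d : s, monomial d.1 (c d)

section Coefficients

variable {σ R : Type*} [CommSemiring R]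

theorem coeff_ofCoeffs (s : Finset (σ →₀ ℕ)) (c : s → R) (d : σ →₀ ℕ) :
    coeff d (ofCoeffs s c) = if h : d ∈ s then c ⟨d, h⟩ else 0 := by
  simp only [ofCoeffs, coeff_sum, coeff_monomial]
  split_ifs with h
  · rw [Finset.sum_eq_single ⟨d, h⟩]
    · simp
    · intro b _ hb
      rw [if_neg fun hbd => hb (Subtype.ext hbd)]
    · simp
  · refine Finset.sum_eq_zero fun b _ => if_neg ?_
    rintro rfl
    exact h b.2

theorem ofCoeffs_coeff {s : Finset (σ →₀ ℕ)} {p : MvPolynomial σ R} (hp : p.support ⊆ s) :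
    ofCoeffs s (fun d => coeff d.1 p) = p := by
  ext d
  rw [coeff_ofCoeffs]
  split_ifs with h
  · rfl
  · exact (notMem_support_iff.1 fun hd => h (hp hd)).symm

theorem support_ofCoeffs_subset (s : Finset (σ →₀ ℕ)) (c : s → R) :
    (ofCoeffs s c).support ⊆ s := by
  intro d hd
  by_contra h
  rw [mem_support_iff, coeff_ofCoeffs, dif_neg h] at hd
  exact hd rfl

theorem support_subset_Iic_iff [DecidableEq σ] {p : MvPolynomial σ R} {n : σ →₀ ℕ} :
    p.support ⊆ Finset.Iic n ↔ ∀ i, p.degreeOf i ≤ n i := by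
  simp only [degreeOf_le_iff, Finset.subset_iff, Finset.mem_Iic, Finsupp.le_def]
  exact ⟨fun h i d hd => h hd i, fun h d hd i => h i d hd⟩

variable [Fintype σ]

@[simp]
theorem multidegree_apply (p : MvPolynomial σ R) (i : σ) :
    multidegree p i = p.degreeOf i := rfl

theorem support_subset_Iic_multidegree [DecidableEq σ] (p : MvPolynomial σ R) :
    p.support ⊆ Finset.Iic (multidegree p) :=
  support_subset_Iic_iff.2 fun _ => le_rfl

theorem isUnit_of_multidegree_eq_zero {K : Type*} [Field K] {p : MvPolynomial σ K} (hp : p ≠ 0)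
    (h : multidegree p = 0) : IsUnit p := by
  have hC : p = C (coeff 0 p) := by
    rw [← totalDegree_eq_zero_iff_eq_C, totalDegree_eq_zero_iff]
    intro d hd i
    have := support_subset_Iic_multidegree p hd
    rw [h, Finset.mem_Iic, Finsupp.le_def] at this
    simpa using this i
  rw [hC]
  refine (IsUnit.mk0 _ fun h0 => hp ?_).map C
  rw [hC, h0, C_0]

end Coefficients

/-- For nonzero `a` and `b` whose sum has two positive coordinates, the exponents strictly below `a`
and the exponents `a + c` with `c ≤ b` are disjoint and miss some exponent below `a + b`. -/
theorem card_Iic_add_card_Iic_le {σ : Type*} [DecidableEq σ] {a b : σ →₀ ℕ} (ha : a ≠ 0)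
    (hb : b ≠ 0) (hab : ∃ i j, i ≠ j ∧ 0 < (a + b) i ∧ 0 < (a + b) j) :
    (Finset.Iic a).card + (Finset.Iic b).card ≤ (Finset.Iic (a + b)).card := by
  obtain ⟨i, j, hij, hai, hbj⟩ : ∃ i j, i ≠ j ∧ 0 < a i ∧ 0 < b j := by
    obtain ⟨i, hi⟩ := Finsupp.ne_iff.1 ha
    obtain ⟨j, hj⟩ := Finsupp.ne_iff.1 hb
    obtain ⟨r, s, hrs, hr, hs⟩ := hab
    simp only [Finsupp.coe_zero, Pi.zero_apply, Finsupp.add_apply] at hi hj hr hs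
    by_contra! hne
    have hij : i = j := by
      by_contra h
      exact hj (Nat.le_zero.1 (hne i j h (Nat.pos_of_ne_zero hi)))
    obtain ⟨x, hxi, hx⟩ : ∃ x, x ≠ i ∧ 0 < a x + b x := by
      by_cases hri : r = i
      · exact ⟨s, fun h => hrs (hri.trans h.symm), hs⟩
      · exact ⟨r, hri, hr⟩
    have hbx := hne i x hxi.symm (Nat.pos_of_ne_zero hi)
    have hbj := hne x j (hij ▸ hxi) (by omega)
    omega
  let e : σ →₀ ℕ := Finsupp.single j (a j + b j)
  have hei : e i = 0 := Finsupp.single_eq_of_ne hij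
  have hej : e j = a j + b j := Finsupp.single_eq_same
  have hshift : (Finset.Iic b).card = ((Finset.Iic b).image (a + ·)).card :=
    (Finset.card_image_of_injective _ (add_right_injective a)).symm
  have hIio : (Finset.Iic a).card = (Finset.Iio a).card + 1 := by
    rw [← Finset.Iio_insert, Finset.card_insert_of_notMem (by simp)]
  have hdisj : Disjoint (Finset.Iio a) ((Finset.Iic b).image (a + ·)) := by
    rw [Finset.disjoint_left]
    intro d hd hd'
    obtain ⟨c, -, rfl⟩ := Finset.mem_image.1 hd'
    exact (Finset.mem_Iio.1 hd).not_ge le_self_add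
  have he : e ∉ Finset.Iio a ∪ (Finset.Iic b).image (a + ·) := by
    rw [Finset.mem_union, Finset.mem_image]
    rintro (h | ⟨c, -, h⟩)
    · have := (Finset.mem_Iio.1 h).le j
      omega
    · have := DFunLike.congr_fun h i
      simp only [Finsupp.add_apply] at this
      omega
  rw [hIio, hshift, add_right_comm, ← Finset.card_union_of_disjoint hdisj,
    ← Finset.card_insert_of_notMem he]
  refine Finset.card_le_card ?_
  intro d hd
  rw [Finset.mem_insert, Finset.mem_union, Finset.mem_image] at hd
  rw [Finset.mem_Iic]
  rcases hd with rfl | hd | ⟨c, hc, rfl⟩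
  · exact Finsupp.single_le_iff.2 le_rfl
  · exact (Finset.mem_Iio.1 hd).le.trans le_self_add
  · exact add_le_add_right (Finset.mem_Iic.1 hc) a

section Products

variable {ℓ : ℕ}

/-- The coefficients, on exponents below `n`, of the product of a polynomial with exponents below
`a` whose coefficient at `d` is `1` and a polynomial with exponents below `b`. -/
noncomputable def productCoeffs (n a b d : Fin ℓ →₀ ℕ)
    (x : (↥((Finset.Iic a).erase d) → ℂ) × (↥(Finset.Iic b) → ℂ)) : ↥(Finset.Iic n) → ℂ :=
  fun e => coeff e.1 ((monomial d 1 + ofCoeffs _ x.1) * ofCoeffs _ x.2)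

theorem contDiff_productCoeffs (n a b d : Fin ℓ →₀ ℕ) :
    ContDiff ℝ 1 (productCoeffs n a b d) := by
  refine contDiff_pi.2 fun e => ?_
  simp only [productCoeffs, coeff_mul, coeff_add, coeff_ofCoeffs]
  refine ContDiff.sum fun i _ => ContDiff.mul (contDiff_const.add ?_) ?_ <;> split_ifs <;> fun_prop

theorem finrank_real_pi_complex (ι : Type*) [Fintype ι] :
    Module.finrank ℝ (ι → ℂ) = 2 * Fintype.card ι := by
  rw [finrank_real_of_complex, Module.finrank_fintype_fun_eq_card]

theorem dimH_range_productCoeffs_le {n a b d : Fin ℓ →₀ ℕ} (hn : a + b = n) (ha : a ≠ 0)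
    (hb : b ≠ 0) (hd : d ≤ a) (h2 : ∃ i j, i ≠ j ∧ 0 < n i ∧ 0 < n j) :
    dimH (Set.range (productCoeffs n a b d)) ≤ ((2 * ((Finset.Iic n).card - 1) : ℕ) : ENNReal) := by
  subst hn
  refine (contDiff_productCoeffs _ a b d).dimH_range_le.trans (Nat.cast_le.2 ?_)
  have hcard := card_Iic_add_card_Iic_le ha hb h2
  have herase := Finset.card_erase_of_mem (Finset.mem_Iic.2 hd)
  have hpos : 0 < (Finset.Iic a).card := Finset.card_pos.2 ⟨d, Finset.mem_Iic.2 hd⟩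
  rw [Module.finrank_prod, finrank_real_pi_complex, finrank_real_pi_complex, Fintype.card_coe,
    Fintype.card_coe]
  omega

/-- The coefficient vectors of all normalised products with factors of nonzero degrees summing
to `n`. -/
def reducibleCoeffs (n : Fin ℓ →₀ ℕ) : Set (↥(Finset.Iic n) → ℂ) :=
  ⋃ x : {x : (Fin ℓ →₀ ℕ) × (Fin ℓ →₀ ℕ) × (Fin ℓ →₀ ℕ) //
      x.1 + x.2.1 = n ∧ x.1 ≠ 0 ∧ x.2.1 ≠ 0 ∧ x.2.2 ≤ x.1},
    Set.range (productCoeffs n x.1.1 x.1.2.1 x.1.2.2)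

theorem dense_compl_reducibleCoeffs {n : Fin ℓ →₀ ℕ} (h2 : ∃ i j, i ≠ j ∧ 0 < n i ∧ 0 < n j) :
    Dense (reducibleCoeffs n)ᶜ := by
  refine dense_compl_of_dimH_lt_finrank ?_
  have hle : dimH (reducibleCoeffs n) ≤ ((2 * ((Finset.Iic n).card - 1) : ℕ) : ENNReal) := by
    rw [reducibleCoeffs, dimH_iUnion]
    exact iSup_le fun x => dimH_range_productCoeffs_le x.2.1 x.2.2.1 x.2.2.2.1 x.2.2.2.2 h2
  refine hle.trans_lt (Nat.cast_lt.2 ?_)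
  have hpos : 0 < (Finset.Iic n).card := Finset.card_pos.2 ⟨n, Finset.mem_Iic.2 le_rfl⟩
  rw [finrank_real_pi_complex, Fintype.card_coe]
  omega

theorem coeffs_mul_mem_reducibleCoeffs {n : Fin ℓ →₀ ℕ} {u v : MvPolynomial (Fin ℓ) ℂ}
    (hu : u ≠ 0) (hn : multidegree u + multidegree v = n) (hu0 : multidegree u ≠ 0)
    (hv0 : multidegree v ≠ 0) :
    (fun e => coeff e.1 (u * v)) ∈ reducibleCoeffs n := by
  obtain ⟨d, hd⟩ := MvPolynomial.ne_zero_iff.1 hu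
  have hda : d ∈ Finset.Iic (multidegree u) :=
    support_subset_Iic_multidegree u (mem_support_iff.2 hd)
  refine Set.mem_iUnion.2 ⟨⟨(multidegree u, multidegree v, d), hn, hu0, hv0,
    Finset.mem_Iic.1 hda⟩, ⟨fun e => (coeff d u)⁻¹ * coeff e.1 u,
    fun e => coeff e.1 (C (coeff d u) * v)⟩, ?_⟩
  funext e
  have hleft : monomial d 1 + ofCoeffs ((Finset.Iic (multidegree u)).erase d)
      (fun e => (coeff d u)⁻¹ * coeff e.1 u) = C (coeff d u)⁻¹ * u := by
    ext e
    rw [coeff_add, coeff_monomial, coeff_ofCoeffs, coeff_C_mul]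
    by_cases hed : d = e
    · subst hed
      simp [hd]
    · by_cases hea : e ∈ Finset.Iic (multidegree u)
      · rw [dif_pos (Finset.mem_erase.2 ⟨Ne.symm hed, hea⟩), if_neg hed, zero_add]
      · have he0 : coeff e u = 0 :=
          notMem_support_iff.1 fun h => hea (support_subset_Iic_multidegree u h)
        rw [dif_neg fun h => hea (Finset.mem_of_mem_erase h), if_neg hed, he0, mul_zero, zero_add]
  have hright : ofCoeffs (Finset.Iic (multidegree v)) (fun e => coeff e.1 (C (coeff d u) * v))
      = C (coeff d u) * v :=
    ofCoeffs_coeff <| support_subset_Iic_iff.2 fun i => degreeOf_C_mul_le _ _ _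
  have hprod : C (coeff d u)⁻¹ * u * (C (coeff d u) * v) = u * v := by
    rw [mul_mul_mul_comm, ← C_mul, inv_mul_cancel₀ hd, C_1, one_mul]
  simp only [productCoeffs]
  rw [hleft, hright, hprod]

theorem irreducible_of_notMem_reducibleCoeffs {n : Fin ℓ →₀ ℕ} (hn : n ≠ 0)
    {p : MvPolynomial (Fin ℓ) ℂ} (hp : multidegree p = n)
    (hmem : (fun e => coeff e.1 p) ∉ reducibleCoeffs n) : Irreducible p := by
  have hp0 : p ≠ 0 := by
    rintro rfl
    exact hn (hp ▸ Finsupp.ext fun i => by simp)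
  refine ⟨fun hunit => hn ?_, fun u v huv => ?_⟩
  · rw [← hp]
    obtain ⟨r, -, rfl⟩ := isUnit_iff_eq_C_of_isReduced.1 hunit
    exact Finsupp.ext fun i => by simp
  · subst huv
    have hu := left_ne_zero_of_mul hp0
    have hv := right_ne_zero_of_mul hp0
    by_contra! hne
    refine hmem (coeffs_mul_mem_reducibleCoeffs hu ?_
      (fun h => hne.1 (isUnit_of_multidegree_eq_zero hu h))
      (fun h => hne.2 (isUnit_of_multidegree_eq_zero hv h)))
    rw [← hp]
    exact Finsupp.ext fun i => (degreeOf_mul_eq hu hv).symm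

end Products

section Continuity

variable {X σ R : Type*} [TopologicalSpace X] [CommSemiring R] [TopologicalSpace R]

theorem continuous_coeff_ofCoeffs (s : Finset (σ →₀ ℕ)) (d : σ →₀ ℕ) :
    Continuous fun c : s → R => coeff d (ofCoeffs s c) := by
  simp only [coeff_ofCoeffs]
  split_ifs <;> fun_prop

variable [IsTopologicalSemiring R]

theorem continuous_coeff_mul {P Q : X → MvPolynomial σ R}
    (hP : ∀ d, Continuous fun x => coeff d (P x)) (hQ : ∀ d, Continuous fun x => coeff d (Q x))
    (d : σ →₀ ℕ) : Continuous fun x => coeff d (P x * Q x) := by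
  simp only [coeff_mul]
  exact continuous_finsetSum _ fun i _ => (hP _).mul (hQ _)

theorem continuous_coeff_pow {P : X → MvPolynomial σ R}
    (hP : ∀ d, Continuous fun x => coeff d (P x)) (k : ℕ) (d : σ →₀ ℕ) :
    Continuous fun x => coeff d (P x ^ k) := by
  induction k generalizing d with
  | zero => simpa using continuous_const
  | succ k ih =>
    simp only [pow_succ]
    exact continuous_coeff_mul ih hP d

end Continuity

theorem pNorm_eq_sqrt_sum {ℓ : ℕ} {p : MvPolynomial (Fin ℓ) ℂ} {s : Finset (Fin ℓ →₀ ℕ)}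
    (hp : p.support ⊆ s) : pNorm p = √(∑ d ∈ s, Complex.normSq (coeff d p)) := by
  rw [pNorm, pInner, Finset.union_self, Complex.re_sum]
  congr 1
  refine (Finset.sum_congr rfl fun d _ => ?_).trans
    (Finset.sum_subset hp fun d _ hd => by rw [notMem_support_iff.1 hd, map_zero])
  rw [← Complex.normSq_eq_conj_mul_self, Complex.ofReal_re]

theorem continuous_pNorm {X : Type*} [TopologicalSpace X] {ℓ : ℕ}
    {P : X → MvPolynomial (Fin ℓ) ℂ} (s : Finset (Fin ℓ →₀ ℕ)) (hs : ∀ x, (P x).support ⊆ s)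
    (hP : ∀ d, Continuous fun x => coeff d (P x)) : Continuous fun x => pNorm (P x) := by
  simp only [fun x => pNorm_eq_sqrt_sum (hs x)]
  exact Real.continuous_sqrt.comp
    (continuous_finsetSum _ fun d _ => Complex.continuous_normSq.comp (hP d))

theorem continuous_pNorm_sub_ofCoeffs_pow_mul {ℓ : ℕ} (n : Fin ℓ →₀ ℕ)
    (f g : MvPolynomial (Fin ℓ) ℂ) (k : ℕ) :
    Continuous fun c : ↥(Finset.Iic n) → ℂ => pNorm (f - ofCoeffs _ c ^ k * g) := by
  refine continuous_pNorm (Finset.Iic (multidegree f ⊔ (k • n + multidegree g))) (fun c => ?_)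
    fun d => ?_
  · refine support_subset_Iic_iff.2 fun i => (degreeOf_sub_le _ _ _).trans
      (max_le_max le_rfl ((degreeOf_mul_le _ _ _).trans
        (add_le_add ((degreeOf_pow_le _ _ _).trans ?_) le_rfl)))
    exact Nat.mul_le_mul_left k (support_subset_Iic_iff.1 (support_ofCoeffs_subset _ c) i)
  · simp only [coeff_sub]
    exact continuous_const.sub (continuous_coeff_mul
      (continuous_coeff_pow (continuous_coeff_ofCoeffs _) k) (fun _ => continuous_const) d)

theorem eventually_multidegree_ofCoeffs {ℓ : ℕ} {n : Fin ℓ →₀ ℕ} {p : MvPolynomial (Fin ℓ) ℂ}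
    (hp0 : p ≠ 0) (hp : multidegree p = n) :
    ∀ᶠ c in nhds (fun d : ↥(Finset.Iic n) => coeff d.1 p), multidegree (ofCoeffs _ c) = n := by
  have hcoeff : ofCoeffs (Finset.Iic n) (fun d => coeff d.1 p) = p :=
    ofCoeffs_coeff (hp ▸ support_subset_Iic_multidegree p)
  have hev : ∀ i, ∀ᶠ c in nhds (fun d : ↥(Finset.Iic n) => coeff d.1 p),
      n i ≤ (ofCoeffs _ c).degreeOf i := by
    intro i
    obtain ⟨d, hd, hdi⟩ := Finset.exists_mem_eq_sup p.support (support_nonempty.2 hp0)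
      fun m => m i
    rw [← degreeOf_eq_sup, ← multidegree_apply, hp] at hdi
    have hne := (continuous_coeff_ofCoeffs (R := ℂ) (Finset.Iic n) d).continuousAt.eventually_ne
      (x := fun d => coeff d.1 p) (y := 0) (by rwa [hcoeff, ← mem_support_iff])
    filter_upwards [hne] with c hc
    rw [hdi]
    exact monomial_le_degreeOf i (mem_support_iff.2 hc)
  filter_upwards [Filter.eventually_all.2 hev] with c hc
  exact Finsupp.ext fun i =>
    (support_subset_Iic_iff.1 (support_ofCoeffs_subset _ c) i).antisymm (hc i)

/-- Degree-combining embedding: if `f_1, f_2` are irreducible and non-associated with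
`deg f_1 = n_1`, `deg f_2 = n_2` and `n_1 + n_2` non-univariate, then
`f = f_1^k · f_2^k · g` lies in the closure (in the coefficient-norm topology of `ℙ^m`,
`m = deg f`) of `{p^k · g : p irreducible, deg p = n_1 + n_2}`. -/
theorem degree_combining_embedding (ℓ : ℕ) (hl : 1 ≤ ℓ)
    (f₁ f₂ : MvPolynomial (Fin ℓ) ℂ) (n₁ n₂ : Fin ℓ → ℕ)
    (hirr₁ : Irreducible f₁) (hirr₂ : Irreducible f₂)
    (hassoc : ¬ Associated f₁ f₂)
    (hdeg₁ : ∀ t, f₁.degreeOf t = n₁ t) (hdeg₂ : ∀ t, f₂.degreeOf t = n₂ t)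
    (hnu : ∃ i j : Fin ℓ, i ≠ j ∧ 0 < n₁ i + n₂ i ∧ 0 < n₁ j + n₂ j)
    (g : MvPolynomial (Fin ℓ) ℂ) (k : ℕ) (hk : 1 ≤ k) :
    ∀ ε : ℝ, 0 < ε →
      ∃ p : MvPolynomial (Fin ℓ) ℂ, Irreducible p ∧
        (∀ t, p.degreeOf t = n₁ t + n₂ t) ∧
        pNorm (f₁ ^ k * f₂ ^ k * g - p ^ k * g) < ε := by
  intro ε hε
  let n : Fin ℓ →₀ ℕ := Finsupp.equivFunOnFinite.symm fun t => n₁ t + n₂ t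
  have hF0 : f₁ * f₂ ≠ 0 := mul_ne_zero hirr₁.ne_zero hirr₂.ne_zero
  have hFn : multidegree (f₁ * f₂) = n := Finsupp.ext fun t => by
    rw [multidegree_apply, degreeOf_mul_eq hirr₁.ne_zero hirr₂.ne_zero, hdeg₁, hdeg₂]
    rfl
  have hn : n ≠ 0 := by
    obtain ⟨i, -, -, hi, -⟩ := hnu
    exact fun h => hi.ne' (DFunLike.congr_fun h i)
  have hcoeff : ofCoeffs (Finset.Iic n) (fun d => coeff d.1 (f₁ * f₂)) = f₁ * f₂ :=
    ofCoeffs_coeff (hFn ▸ support_subset_Iic_multidegree _)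
  have hclose := (continuous_pNorm_sub_ofCoeffs_pow_mul n (f₁ ^ k * f₂ ^ k * g) g k).tendsto
    (fun d => coeff d.1 (f₁ * f₂)) |>.eventually_lt_const (u := ε) <| by
      rw [hcoeff, mul_pow, sub_self]
      simpa [pNorm, pInner] using hε
  obtain ⟨c, hc, hdeg, hlt⟩ := ((mem_closure_iff_frequently.1
    (dense_compl_reducibleCoeffs (n := n) hnu _)).and_eventually
      ((eventually_multidegree_ofCoeffs hF0 hFn).and hclose)).exists
  refine ⟨ofCoeffs _ c, irreducible_of_notMem_reducibleCoeffs hn hdeg ?_,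
    fun t => DFunLike.congr_fun hdeg t, hlt⟩
  convert hc using 2
  funext e
  simp [coeff_ofCoeffs]
end
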